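/- For all integers i, s, s′ with 1 ≤ s′ < s ≤ i ≤ n, one has u_i^s · u_i^{s′} = u_{i-1}^{s′} · u_i^s in A. -/

import Mathlib

/-- `uElt T i j` is the element `u_i^j`: the product `T_i T_{i-1} ⋯ T_{i-j+1}`
(interpreted as `1` when `j = 0`). -/
def uElt {A : Type*} [Monoid A] (T : ℕ → A) (i j : ℕ) : A :=
  ((List.range j).map fun t => T (i - t)).prod

theorem uElt_succ_aux {A : Type*} [Monoid A] (T : ℕ → A) (i j : ℕ) :
    uElt T i (j + 1) = uElt T i j * T (i - j) := by
  simp [uElt, List.range_succ]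

theorem uElt_comm_aux {A : Type*} [Monoid A] (n : ℕ) (T : ℕ → A)
    (hcomm : ∀ j k, 1 ≤ j → j ≤ n → 1 ≤ k → k ≤ n → 2 ≤ |(j : ℤ) - (k : ℤ)| →
      T j * T k = T k * T j) (i k : ℕ) (hin : i ≤ n) (hk : 1 ≤ k) (t : ℕ) (h : k + t < i) :
    uElt T i t * T k = T k * uElt T i t := by
  induction t with
  | zero => simp [uElt]
  | succ t ih =>
    have h2 : T (i - t) * T k = T k * T (i - t) := by
      apply hcomm <;> try omega
      rw [le_abs]; omega
    rw [uElt_succ_aux, mul_assoc, h2, ← mul_assoc, ih (by omega), mul_assoc]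

theorem uElt_shift_aux {A : Type*} [Monoid A] (n : ℕ) (T : ℕ → A)
    (hcomm : ∀ j k, 1 ≤ j → j ≤ n → 1 ≤ k → k ≤ n → 2 ≤ |(j : ℤ) - (k : ℤ)| →
      T j * T k = T k * T j)
    (hbraid : ∀ j, 1 ≤ j → j + 1 ≤ n →
      T j * T (j + 1) * T j = T (j + 1) * T j * T (j + 1))
    (i t : ℕ) (hin : i ≤ n) (s : ℕ) (hts : t + 1 < s) (hs : s ≤ i) :
    uElt T i s * T (i - t) = T (i - 1 - t) * uElt T i s := by
  induction s with
  | zero => omega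
  | succ s ih =>
    by_cases h : t + 1 < s
    · have h2 : T (i - s) * T (i - t) = T (i - t) * T (i - s) := by
        apply hcomm <;> try omega
        rw [le_abs]; omega
      rw [uElt_succ_aux, mul_assoc, h2, ← mul_assoc, ih h (by omega), mul_assoc]
    · obtain rfl : s = t + 1 := by omega
      obtain ⟨m, rfl⟩ : ∃ m, i = m + 1 + t := ⟨i - 1 - t, by omega⟩
      have h1 := uElt_comm_aux n T hcomm (m + 1 + t) m hin (by omega) t (by omega)
      have h2 := hbraid m (by omega) (by omega)
      rw [uElt_succ_aux, uElt_succ_aux, show m + 1 + t - t = m + 1 by omega,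
        show m + 1 + t - (t + 1) = m by omega, show m + 1 + t - 1 - t = m by omega]
      calc _ = uElt T (m + 1 + t) t * (T (m + 1) * T m * T (m + 1)) := by simp only [mul_assoc]
        _ = (uElt T (m + 1 + t) t * T m) * (T (m + 1) * T m) := by
          rw [← h2]; simp only [mul_assoc]
        _ = _ := by rw [h1]; simp only [mul_assoc]

theorem u_mul_u_lt {K : Type*} [Field K] (q : K) {A : Type*} [Ring A] [Algebra K A]
    (n : ℕ) (T : ℕ → A)
    (hcomm : ∀ j k, 1 ≤ j → j ≤ n → 1 ≤ k → k ≤ n → 2 ≤ |(j : ℤ) - (k : ℤ)| →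
      T j * T k = T k * T j)
    (hbraid : ∀ j, 1 ≤ j → j + 1 ≤ n →
      T j * T (j + 1) * T j = T (j + 1) * T j * T (j + 1))
    (hquad : ∀ j, 1 ≤ j → j ≤ n → T j ^ 2 = (q - 1) • T j + q • (1 : A))
    (i s s' : ℕ) (hs' : 1 ≤ s') (hs's : s' < s) (hsi : s ≤ i) (hin : i ≤ n) :
    uElt T i s * uElt T i s' = uElt T (i - 1) s' * uElt T i s := by
  clear hs'
  induction s' with
  | zero => simp [uElt]
  | succ t ih =>
    rw [uElt_succ_aux T i t, uElt_succ_aux T (i - 1) t, ← mul_assoc, ih (by omega), mul_assoc,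
      uElt_shift_aux n T hcomm hbraid i t hin s hs's hsi, mul_assoc]
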